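/- arXiv:2209.04540 — 2 statements merged into one kernel-verified Lean document; each statement's English description precedes it below -/
import Mathlib

section
/- Let K ⊂ ℝᵈ be a convex body (compact convex set with nonempty interior) that is not centrally symmetric. Then D = ½(K − K) is a packing region for K, and m(D) > m(K). -/
open MeasureTheory Set Pointwise

noncomputable section

/-- The essential difference set `Δ(A) = { t : m(A ∩ (A + t)) > 0 }`. -/
def essDiff {E : Type*} [MeasureSpace E] [Sub E] (A : Set E) : Set E :=
  {t | 0 < volume (A ∩ {x | x - t ∈ A})}

/-- A function on an interval whose primitive from the left endpoint is a change of variables: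
it is integrable, and continuous and positive in the interior of the interval. -/
structure IsPosDensityOn (f : ℝ → ℝ) (a b : ℝ) : Prop where
  lt : a < b
  integrable : Integrable f
  continuousOn : ContinuousOn f (Ioo a b)
  pos : ∀ s ∈ Ioo a b, 0 < f s

namespace IsPosDensityOn

variable {f g : ℝ → ℝ} {a b c d : ℝ}

lemma hasDerivAt_primitive (hf : IsPosDensityOn f a b) {s : ℝ} (hs : s ∈ Ioo a b) :
    HasDerivAt (fun x => ∫ y in a..x, f y) (f s) s :=
  intervalIntegral.integral_hasDerivAt_right hf.integrable.intervalIntegrable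
    hf.integrable.aestronglyMeasurable.stronglyMeasurableAtFilter
    (hf.continuousOn.continuousAt (isOpen_Ioo.mem_nhds hs))

lemma continuousOn_primitive (hf : IsPosDensityOn f a b) :
    ContinuousOn (fun x => ∫ y in a..x, f y) (Icc a b) := by
  have h := intervalIntegral.continuousOn_primitive_interval (μ := volume) (f := f) (a := a)
    (b := b) hf.integrable.integrableOn
  rwa [uIcc_of_le hf.lt.le] at h

lemma strictMonoOn_primitive (hf : IsPosDensityOn f a b) :
    StrictMonoOn (fun x => ∫ y in a..x, f y) (Icc a b) := by
  refine strictMonoOn_of_deriv_pos (convex_Icc a b) hf.continuousOn_primitive fun x hx => ?_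
  rw [interior_Icc] at hx
  rw [(hf.hasDerivAt_primitive hx).deriv]
  exact hf.pos x hx

lemma primitive_mem (hf : IsPosDensityOn f a b) {s : ℝ} (hs : s ∈ Ioo a b) :
    ∫ y in a..s, f y ∈ Ioo 0 (∫ y in a..b, f y) := by
  have h := hf.strictMonoOn_primitive
  have h1 := h (left_mem_Icc.2 hf.lt.le) (Ioo_subset_Icc_self hs) hs.1
  have h2 := h (Ioo_subset_Icc_self hs) (right_mem_Icc.2 hf.lt.le) hs.2
  simp only [intervalIntegral.integral_same] at h1
  exact ⟨h1, h2⟩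

lemma integral_pos (hf : IsPosDensityOn f a b) : 0 < ∫ y in a..b, f y := by
  obtain ⟨s, hs⟩ := nonempty_Ioo.2 hf.lt
  exact (hf.primitive_mem hs).1.trans (hf.primitive_mem hs).2

/-- The primitive of a positive density has a differentiable inverse. -/
lemma exists_inverse_primitive (hf : IsPosDensityOn f a b) :
    ∃ N : ℝ → ℝ, ∀ y ∈ Ioo 0 (∫ y in a..b, f y),
      N y ∈ Ioo a b ∧ ∫ x in a..N y, f x = y ∧ HasDerivAt N (f (N y))⁻¹ y := by
  set F : ℝ → ℝ := fun x => ∫ y in a..x, f y with hF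
  have hsurj : Ioo 0 (F b) ⊆ F '' Ioo a b := by
    have := intermediate_value_Ioo hf.lt.le hf.continuousOn_primitive
    simpa [hF] using this
  set N := Function.invFunOn F (Ioo a b) with hN
  have hmem : ∀ y ∈ Ioo 0 (F b), N y ∈ Ioo a b := fun y hy =>
    Function.invFunOn_mem (hsurj hy)
  have heq : ∀ y ∈ Ioo 0 (F b), F (N y) = y := fun y hy =>
    Function.invFunOn_eq (hsurj hy)
  have hFm : StrictMonoOn F (Ioo a b) := hf.strictMonoOn_primitive.mono Ioo_subset_Icc_self
  have hmono : MonotoneOn N (Ioo 0 (F b)) := by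
    intro y hy z hz hyz
    rw [← hFm.le_iff_le (hmem y hy) (hmem z hz), heq y hy, heq z hz]
    exact hyz
  have himage : Ioo a b ⊆ N '' Ioo 0 (F b) := fun s hs =>
    ⟨F s, hf.primitive_mem hs, hFm.injOn (hmem _ (hf.primitive_mem hs)) hs
      (heq _ (hf.primitive_mem hs))⟩
  refine ⟨N, fun y hy => ⟨hmem y hy, heq y hy, ?_⟩⟩
  have hcont : ContinuousAt N y :=
    continuousAt_of_monotoneOn_of_image_mem_nhds hmono (isOpen_Ioo.mem_nhds hy)
      (Filter.mem_of_superset (isOpen_Ioo.mem_nhds (hmem y hy)) himage)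
  refine HasDerivAt.of_local_left_inverse hcont (hf.hasDerivAt_primitive (hmem y hy))
    (hf.pos _ (hmem y hy)).ne' ?_
  filter_upwards [isOpen_Ioo.mem_nhds hy] with z hz using heq z hz

/-- The increasing map transporting the normalised density `f` to the normalised density `g`. -/
lemma exists_transport (hf : IsPosDensityOn f a b) (hg : IsPosDensityOn g c d) :
    ∃ T : ℝ → ℝ, T '' Ioo a b = Ioo c d ∧ ∀ s ∈ Ioo a b,
      HasDerivAt T ((∫ y in c..d, g y) / (∫ y in a..b, f y) * f s / g (T s)) s := by
  obtain ⟨N, hN⟩ := hg.exists_inverse_primitive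
  set V := ∫ y in a..b, f y with hV
  set W := ∫ y in c..d, g y with hW
  have hV0 : 0 < V := hf.integral_pos
  have hW0 : 0 < W := hg.integral_pos
  have hmem : ∀ s ∈ Ioo a b, W / V * ∫ y in a..s, f y ∈ Ioo 0 W := fun s hs => by
    obtain ⟨h1, h2⟩ := hf.primitive_mem hs
    refine ⟨by positivity, ?_⟩
    rw [div_mul_eq_mul_div, div_lt_iff₀ hV0]
    exact mul_lt_mul_of_pos_left h2 hW0
  refine ⟨fun s => N (W / V * ∫ y in a..s, f y), ?_, fun s hs => ?_⟩
  · apply Subset.antisymm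
    · rintro _ ⟨s, hs, rfl⟩
      exact (hN _ (hmem s hs)).1
    · intro t ht
      obtain ⟨M, hM⟩ := hf.exists_inverse_primitive
      obtain ⟨h1, h2⟩ := hg.primitive_mem ht
      have hy : V / W * ∫ y in c..t, g y ∈ Ioo 0 V := by
        refine ⟨by positivity, ?_⟩
        rw [div_mul_eq_mul_div, div_lt_iff₀ hW0]
        exact mul_lt_mul_of_pos_left h2 hV0
      obtain ⟨h3, h4, -⟩ := hM _ hy
      refine ⟨_, h3, ?_⟩
      have h5 : W / V * (V / W * ∫ y in c..t, g y) = ∫ y in c..t, g y := by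
        field_simp
      simp only [h4, h5]
      obtain ⟨h6, h7, -⟩ := hN _ ⟨h1, h2⟩
      exact hg.strictMonoOn_primitive.injOn (Ioo_subset_Icc_self h6) (Ioo_subset_Icc_self ht) h7
  · have h := (hN _ (hmem s hs)).2.2.comp s ((hf.hasDerivAt_primitive hs).const_mul (W / V))
    refine h.congr_deriv ?_
    ring

lemma lintegral_ofReal (hf : IsPosDensityOn f a b) :
    ∫⁻ s in Ioo a b, ENNReal.ofReal (f s) = ENNReal.ofReal (∫ s in a..b, f s) := by
  rw [intervalIntegral.integral_of_le hf.lt.le, integral_Ioc_eq_integral_Ioo,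
    ofReal_integral_eq_lintegral_ofReal hf.integrable.integrableOn]
  filter_upwards [ae_restrict_mem measurableSet_Ioo] with s hs using (hf.pos s hs).le

/-- The common part of the one-dimensional Prékopa–Leindler inequality and of its equality case:
transport of `f` to `g`, followed by the change of variables `s ↦ (s + T s) / 2`. -/
lemma exists_transport_lintegral_le (hf : IsPosDensityOn f a b) (hg : IsPosDensityOn g c d)
    (h : ℝ → ENNReal)
    (hh : ∀ s ∈ Ioo a b, ∀ t ∈ Ioo c d, ENNReal.ofReal √(f s * g t) ≤ h ((s + t) / 2)) :
    ∃ T : ℝ → ℝ, T '' Ioo a b = Ioo c d ∧ (∀ s ∈ Ioo a b,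
      HasDerivAt T ((∫ y in c..d, g y) / (∫ y in a..b, f y) * f s / g (T s)) s) ∧
      ∫⁻ s in Ioo a b, ENNReal.ofReal ((1 + (∫ y in c..d, g y) / (∫ y in a..b, f y) * f s / g (T s))
        / 2 * √(f s * g (T s))) ≤ ∫⁻ x, h x := by
  obtain ⟨T, himg, hT⟩ := hf.exists_transport hg
  refine ⟨T, himg, hT, ?_⟩
  set κ := (∫ y in c..d, g y) / (∫ y in a..b, f y) with hκ
  have hκ0 : 0 < κ := div_pos hg.integral_pos hf.integral_pos
  have hTm : ∀ s ∈ Ioo a b, T s ∈ Ioo c d := fun s hs => himg ▸ mem_image_of_mem T hs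
  have hm : ∀ s ∈ Ioo a b, HasDerivAt (fun s => (s + T s) / 2) ((1 + κ * f s / g (T s)) / 2) s :=
    fun s hs => ((hasDerivAt_id' s).add (hT s hs)).div_const 2
  have hpos : ∀ s ∈ Ioo a b, 0 < (1 + κ * f s / g (T s)) / 2 := fun s hs => by
    have := hf.pos s hs
    have := hg.pos _ (hTm s hs)
    positivity
  have hmono : StrictMonoOn (fun s => (s + T s) / 2) (Ioo a b) := by
    refine strictMonoOn_of_deriv_pos (convex_Ioo a b)
      (fun s hs => (hm s hs).continuousAt.continuousWithinAt) fun s hs => ?_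
    rw [interior_Ioo] at hs
    rw [(hm s hs).deriv]
    exact hpos s hs
  calc _ ≤ ∫⁻ s in Ioo a b, ENNReal.ofReal |(1 + κ * f s / g (T s)) / 2| * h ((s + T s) / 2) := by
        refine setLIntegral_mono' measurableSet_Ioo fun s hs => ?_
        rw [abs_of_pos (hpos s hs), ENNReal.ofReal_mul (hpos s hs).le]
        gcongr
        exact hh s hs _ (hTm s hs)
    _ = ∫⁻ x in (fun s => (s + T s) / 2) '' Ioo a b, h x :=
        (lintegral_image_eq_lintegral_abs_deriv_mul measurableSet_Ioo
          (fun s hs => (hm s hs).hasDerivWithinAt) hmono.injOn h).symm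
    _ ≤ _ := setLIntegral_le_lintegral _ _

/-- The one-dimensional Prékopa–Leindler inequality at the midpoint. -/
lemma ofReal_sqrt_le_lintegral (hf : IsPosDensityOn f a b) (hg : IsPosDensityOn g c d)
    (h : ℝ → ENNReal)
    (hh : ∀ s ∈ Ioo a b, ∀ t ∈ Ioo c d, ENNReal.ofReal √(f s * g t) ≤ h ((s + t) / 2)) :
    ENNReal.ofReal √((∫ s in a..b, f s) * ∫ t in c..d, g t) ≤ ∫⁻ x, h x := by
  obtain ⟨T, himg, -, hle⟩ := hf.exists_transport_lintegral_le hg h hh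
  refine le_trans ?_ hle
  set V := ∫ y in a..b, f y with hV
  set W := ∫ y in c..d, g y with hW
  have hV0 : 0 < V := hf.integral_pos
  have hW0 : 0 < W := hg.integral_pos
  have h1 : √(V * W) = √(W / V) * V := by
    rw [Real.sqrt_eq_iff_mul_self_eq (by positivity) (by positivity)]
    have := Real.mul_self_sqrt (div_pos hW0 hV0).le
    symm
    calc √(W / V) * V * (√(W / V) * V) = √(W / V) * √(W / V) * V * V := by ring
      _ = V * W := by rw [this]; field_simp
  rw [h1, ENNReal.ofReal_mul (Real.sqrt_nonneg _), hV, ← hf.lintegral_ofReal,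
    ← lintegral_const_mul' _ _ ENNReal.ofReal_ne_top]
  refine setLIntegral_mono' measurableSet_Ioo fun s hs => ?_
  rw [← ENNReal.ofReal_mul (Real.sqrt_nonneg _)]
  refine ENNReal.ofReal_le_ofReal ?_
  have hfs := hf.pos s hs
  have hgs : 0 < g (T s) := hg.pos _ (himg ▸ mem_image_of_mem T hs)
  rw [← hV]
  obtain ⟨x, hx, hx2⟩ : ∃ x, 0 < x ∧ f s = x ^ 2 :=
    ⟨√(f s), Real.sqrt_pos.2 hfs, (Real.sq_sqrt hfs.le).symm⟩
  obtain ⟨y, hy, hy2⟩ : ∃ y, 0 < y ∧ g (T s) = y ^ 2 :=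
    ⟨√(g (T s)), Real.sqrt_pos.2 hgs, (Real.sq_sqrt hgs.le).symm⟩
  obtain ⟨z, hz, hz2⟩ : ∃ z, 0 < z ∧ W / V = z ^ 2 :=
    ⟨√(W / V), Real.sqrt_pos.2 (div_pos hW0 hV0), (Real.sq_sqrt (div_pos hW0 hV0).le).symm⟩
  rw [hx2, hy2, hz2, Real.sqrt_sq hz.le, ← mul_pow x y, Real.sqrt_sq (by positivity)]
  have : (1 + z ^ 2 * x ^ 2 / y ^ 2) / 2 * (x * y) - z * x ^ 2 = x * (y - z * x) ^ 2 / (2 * y) := by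
    field_simp
    ring
  have h2 : 0 ≤ x * (y - z * x) ^ 2 / (2 * y) := by positivity
  linarith

/-- The equality case of the one-dimensional Prékopa–Leindler inequality at the midpoint, for
densities of the same mass. -/
lemma exists_translate_of_lintegral_le (hf : IsPosDensityOn f a b) (hg : IsPosDensityOn g c d)
    (h : ℝ → ENNReal)
    (hh : ∀ s ∈ Ioo a b, ∀ t ∈ Ioo c d, ENNReal.ofReal √(f s * g t) ≤ h ((s + t) / 2))
    (hmass : ∫ t in c..d, g t = ∫ s in a..b, f s)
    (hle : ∫⁻ x, h x ≤ ENNReal.ofReal (∫ s in a..b, f s)) :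
    ∃ e, c = a + e ∧ d = b + e ∧ ∀ s ∈ Ioo a b, g (s + e) = f s := by
  obtain ⟨T, himg, hT, hle'⟩ := hf.exists_transport_lintegral_le hg h hh
  rw [hmass, div_self hf.integral_pos.ne'] at hT hle'
  simp only [one_mul] at hT hle'
  have hTm : ∀ s ∈ Ioo a b, T s ∈ Ioo c d := fun s hs => himg ▸ mem_image_of_mem T hs
  have hTc : ContinuousOn T (Ioo a b) := fun s hs => (hT s hs).continuousAt.continuousWithinAt
  have hgT : ContinuousOn (fun s => g (T s)) (Ioo a b) := hg.continuousOn.comp hTc hTm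
  set φ : ℝ → ℝ := fun s => (1 + f s / g (T s)) / 2 * √(f s * g (T s)) with hφ
  have hφc : ContinuousOn φ (Ioo a b) :=
    ((continuousOn_const.add (hf.continuousOn.div hgT fun s hs =>
      (hg.pos _ (hTm s hs)).ne')).div_const 2).mul (hf.continuousOn.mul hgT).sqrt
  have hkey : ∀ s ∈ Ioo a b, ∃ x y, 0 < x ∧ 0 < y ∧ f s = x ^ 2 ∧ g (T s) = y ^ 2 ∧
      φ s - f s = x * (y - x) ^ 2 / (2 * y) := fun s hs => by
    have hfs := hf.pos s hs
    have hgs := hg.pos _ (hTm s hs)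
    refine ⟨√(f s), √(g (T s)), Real.sqrt_pos.2 hfs, Real.sqrt_pos.2 hgs,
      (Real.sq_sqrt hfs.le).symm, (Real.sq_sqrt hgs.le).symm, ?_⟩
    simp only [hφ]
    rw [Real.sqrt_mul hfs.le]
    have hx := Real.sqrt_pos.2 hfs
    have hy := Real.sqrt_pos.2 hgs
    have hx2 := Real.sq_sqrt hfs.le
    have hy2 := Real.sq_sqrt hgs.le
    generalize √(f s) = x at *
    generalize √(g (T s)) = y at *
    rw [← hx2, ← hy2]
    field_simp
    ring
  have hfφ : ∀ s ∈ Ioo a b, f s ≤ φ s := fun s hs => by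
    obtain ⟨x, y, hx, hy, -, -, h1⟩ := hkey s hs
    have : 0 ≤ x * (y - x) ^ 2 / (2 * y) := by positivity
    linarith
  have hae : (fun s => ENNReal.ofReal (f s)) =ᵐ[volume.restrict (Ioo a b)]
      fun s => ENNReal.ofReal (φ s) := by
    refine ae_eq_of_ae_le_of_lintegral_le ?_ ?_ ?_ ?_
    · filter_upwards [ae_restrict_mem measurableSet_Ioo] with s hs
      exact ENNReal.ofReal_le_ofReal (hfφ s hs)
    · rw [hf.lintegral_ofReal]
      exact ENNReal.ofReal_ne_top
    · exact (hφc.aemeasurable measurableSet_Ioo).ennreal_ofReal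
    · rw [hf.lintegral_ofReal]
      exact hle'.trans hle
  have heq := Measure.eqOn_open_of_ae_eq hae isOpen_Ioo
    (ENNReal.continuous_ofReal.comp_continuousOn hf.continuousOn)
    (ENNReal.continuous_ofReal.comp_continuousOn hφc)
  have hfg : ∀ s ∈ Ioo a b, g (T s) = f s := fun s hs => by
    have h0 : φ s = f s := ((ENNReal.ofReal_eq_ofReal_iff (hf.pos s hs).le
      ((hf.pos s hs).le.trans (hfφ s hs))).1 (heq hs)).symm
    obtain ⟨x, y, hx, hy, h1, h2, h3⟩ := hkey s hs
    rw [h0, sub_self, eq_comm, div_eq_zero_iff, mul_eq_zero, sq_eq_zero_iff, sub_eq_zero] at h3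
    rcases h3 with (h3 | h3) | h3
    · exact absurd h3 hx.ne'
    · rw [h1, h2, h3]
    · linarith
  obtain ⟨e, he⟩ := isOpen_Ioo.exists_is_const_of_deriv_eq_zero (f := fun s => T s - s)
    isPreconnected_Ioo
    (fun s hs => ((hT s hs).sub (hasDerivAt_id' s)).differentiableAt.differentiableWithinAt)
    (fun s hs => by
      have h := ((hT s hs).sub (hasDerivAt_id' s)).deriv
      rwa [hfg s hs, div_self (hf.pos s hs).ne', sub_self] at h)
  have hTe : ∀ s ∈ Ioo a b, T s = s + e := fun s hs => by linarith [he s hs]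
  have himg' : Ioo (a + e) (b + e) = Ioo c d := by
    rw [← himg, image_congr hTe, image_add_const_Ioo]
  have hlt : a + e < b + e := by linarith [hf.lt]
  refine ⟨e, ?_, ?_, fun s hs => by rw [← hTe s hs, hfg s hs]⟩
  · rw [← csInf_Ioo hlt, himg', csInf_Ioo hg.lt]
  · rw [← csSup_Ioo hlt, himg', csSup_Ioo hg.lt]

end IsPosDensityOn

section Slices

variable {E : Type*}

section Volume

variable [MeasureSpace E]

/-- The volume of the slice of `A` at first coordinate `s`. -/
def sliceVolume (A : Set (ℝ × E)) (s : ℝ) : ℝ := volume.real (Prod.mk s ⁻¹' A)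

lemma sliceVolume_nonneg (A : Set (ℝ × E)) (s : ℝ) : 0 ≤ sliceVolume A s := measureReal_nonneg

lemma sliceVolume_eq_zero {A : Set (ℝ × E)} {a b s : ℝ} (ha : a ∈ lowerBounds (Prod.fst '' A))
    (hb : b ∈ upperBounds (Prod.fst '' A)) (hs : s ∉ Icc a b) : sliceVolume A s = 0 := by
  have : Prod.mk s ⁻¹' A = ∅ := by
    refine eq_empty_of_forall_notMem fun y hy => hs ⟨?_, ?_⟩
    · exact ha ⟨(s, y), hy, rfl⟩
    · exact hb ⟨(s, y), hy, rfl⟩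
  simp [sliceVolume, this]

end Volume

variable [NormedAddCommGroup E]

lemma exists_isLeast_isGreatest_fst {A : Set (ℝ × E)} (hA : IsCompact A) (hne : A.Nonempty) :
    ∃ a b, IsLeast (Prod.fst '' A) a ∧ IsGreatest (Prod.fst '' A) b := by
  obtain ⟨a, ha⟩ := (hA.image continuous_fst).exists_isLeast (hne.image _)
  obtain ⟨b, hb⟩ := (hA.image continuous_fst).exists_isGreatest (hne.image _)
  exact ⟨a, b, ha, hb⟩

lemma IsCompact.preimage_prodMk {A : Set (ℝ × E)} (hA : IsCompact A) (s : ℝ) :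
    IsCompact (Prod.mk s ⁻¹' A) :=
  (hA.image continuous_snd).of_isClosed_subset
    (hA.isClosed.preimage (Continuous.prodMk_right s)) fun y hy => ⟨(s, y), hy, rfl⟩

lemma ofReal_sliceVolume [MeasureSpace E]
    [(volume : Measure E).IsAddHaarMeasure] {A : Set (ℝ × E)} (hA : IsCompact A) (s : ℝ) :
    ENNReal.ofReal (sliceVolume A s) = volume (Prod.mk s ⁻¹' A) :=
  ofReal_measureReal (hA.preimage_prodMk s).measure_ne_top

variable [NormedSpace ℝ E]

lemma Convex.preimage_prodMk {A : Set (ℝ × E)} (hA : Convex ℝ A) (s : ℝ) :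
    Convex ℝ (Prod.mk s ⁻¹' A) := by
  intro x hx y hy α β hα hβ hαβ
  have h := hA hx hy hα hβ hαβ
  simpa [← add_mul, hαβ] using h

variable [MeasureSpace E]
  [FiniteDimensional ℝ E] [BorelSpace E] [(volume : Measure E).IsAddHaarMeasure]

lemma lintegral_volume_preimage_prodMk {A : Set (ℝ × E)} (hA : IsCompact A) :
    ∫⁻ s, volume (Prod.mk s ⁻¹' A) = volume A := by
  rw [Measure.volume_eq_prod, Measure.prod_apply hA.measurableSet]

lemma lintegral_sliceVolume {A : Set (ℝ × E)} (hA : IsCompact A) :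
    ∫⁻ s, ENNReal.ofReal (sliceVolume A s) = volume A := by
  simp_rw [ofReal_sliceVolume hA, lintegral_volume_preimage_prodMk hA]

lemma measurable_sliceVolume {A : Set (ℝ × E)} (hA : IsCompact A) : Measurable (sliceVolume A) :=
  (measurable_measure_prodMk_left hA.measurableSet).ennreal_toReal

lemma integrable_sliceVolume {A : Set (ℝ × E)} (hA : IsCompact A) :
    Integrable (sliceVolume A) := by
  refine ⟨(measurable_sliceVolume hA).aestronglyMeasurable, ?_⟩
  rw [hasFiniteIntegral_iff_ofReal (Filter.Eventually.of_forall (sliceVolume_nonneg A)),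
    lintegral_sliceVolume hA]
  exact hA.measure_lt_top

lemma integral_sliceVolume {A : Set (ℝ × E)} (hA : IsCompact A) :
    ∫ s, sliceVolume A s = volume.real A := by
  rw [integral_eq_lintegral_of_nonneg_ae (Filter.Eventually.of_forall (sliceVolume_nonneg A))
    (measurable_sliceVolume hA).aestronglyMeasurable, lintegral_sliceVolume hA, Measure.real]

lemma integral_fst_eq_integral_sliceVolume {A : Set (ℝ × E)} (hA : IsCompact A) :
    ∫ x in A, x.1 = ∫ s, s * sliceVolume A s := by
  have hint : Integrable (A.indicator fun x : ℝ × E => x.1) :=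
    (integrable_indicator_iff hA.measurableSet).2
      (continuous_fst.continuousOn.integrableOn_compact hA)
  rw [← integral_indicator hA.measurableSet, Measure.volume_eq_prod, integral_prod _ hint]
  congr 1 with s
  have : (fun y => A.indicator (fun x : ℝ × E => x.1) (s, y)) =
      (Prod.mk s ⁻¹' A).indicator fun _ => s := by
    ext y
    simp only [indicator]
    rfl
  rw [this, integral_indicator_const _ (hA.preimage_prodMk s).measurableSet, sliceVolume,
    smul_eq_mul, mul_comm]

lemma pow_mul_sliceVolume_le {A : Set (ℝ × E)} (hA : IsCompact A) (hconv : Convex ℝ A)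
    {p q θ : ℝ} (hq : q ∈ Prod.fst '' A) (h0 : 0 ≤ θ) (h1 : θ ≤ 1) :
    θ ^ Module.finrank ℝ E * sliceVolume A p ≤ sliceVolume A (θ * p + (1 - θ) * q) := by
  obtain ⟨⟨q, y⟩, hy, rfl⟩ := hq
  have hsub : (1 - θ) • y +ᵥ θ • (Prod.mk p ⁻¹' A) ⊆
      Prod.mk (θ * p + (1 - θ) * q) ⁻¹' A := by
    rintro _ ⟨_, ⟨x, hx, rfl⟩, rfl⟩
    have h := hconv hx hy h0 (sub_nonneg.2 h1) (by ring)
    simpa [add_comm] using h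
  have h2 := measureReal_mono (μ := volume) hsub (hA.preimage_prodMk _).measure_ne_top
  rw [measureReal_def, measure_vadd, Measure.addHaar_smul, ENNReal.toReal_mul,
    ENNReal.toReal_ofReal (abs_nonneg _), abs_of_nonneg (by positivity)] at h2
  exact h2

section

variable {A : Set (ℝ × E)} {a b : ℝ}

lemma sliceVolume_left_le (hA : IsCompact A) (hconv : Convex ℝ A) (ha : a ∈ Prod.fst '' A)
    {s t : ℝ} (hs : a < s) (hst : s ≤ t) :
    ((s - a) / (t - a)) ^ Module.finrank ℝ E * sliceVolume A t ≤ sliceVolume A s := by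
  have hta : 0 < t - a := by linarith
  have h := pow_mul_sliceVolume_le hA hconv (p := t) ha
    (div_nonneg (sub_nonneg.2 hs.le) hta.le) ((div_le_one hta).2 (by linarith))
  convert h using 2
  field_simp
  ring

lemma sliceVolume_right_le (hA : IsCompact A) (hconv : Convex ℝ A) (hb : b ∈ Prod.fst '' A)
    {s t : ℝ} (hst : s ≤ t) (ht : t < b) :
    ((b - t) / (b - s)) ^ Module.finrank ℝ E * sliceVolume A s ≤ sliceVolume A t := by
  have hbs : 0 < b - s := by linarith
  have h := pow_mul_sliceVolume_le hA hconv (p := s) hb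
    (div_nonneg (sub_nonneg.2 ht.le) hbs.le) ((div_le_one hbs).2 (by linarith))
  convert h using 2
  field_simp
  ring

lemma continuousAt_sliceVolume (hA : IsCompact A) (hconv : Convex ℝ A) (ha : a ∈ Prod.fst '' A)
    (hb : b ∈ Prod.fst '' A) {s₀ : ℝ} (hs₀ : s₀ ∈ Ioo a b) :
    ContinuousAt (sliceVolume A) s₀ := by
  set k := Module.finrank ℝ E
  have ha0 : 0 < s₀ - a := sub_pos.2 hs₀.1
  have hb0 : 0 < b - s₀ := sub_pos.2 hs₀.2
  set P : ℝ → ℝ := fun s => ((s - a) / (s₀ - a)) ^ k with hP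
  set Q : ℝ → ℝ := fun s => ((b - s) / (b - s₀)) ^ k with hQ
  have hPc : Continuous P := by fun_prop
  have hQc : Continuous Q := by fun_prop
  have hP0 : P s₀ = 1 := by simp [hP, div_self ha0.ne']
  have hQ0 : Q s₀ = 1 := by simp [hQ, div_self hb0.ne']
  have hlim : ∀ u : ℝ → ℝ, Continuous u → u s₀ = 1 →
      Filter.Tendsto (fun s => u s * sliceVolume A s₀) (nhds s₀) (nhds (sliceVolume A s₀)) :=
    fun u hu h1 => by
      have := (hu.mul_const (sliceVolume A s₀)).tendsto s₀
      rwa [h1, one_mul] at this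
  refine tendsto_of_tendsto_of_tendsto_of_le_of_le'
    (hlim (fun s => min (P s) (Q s)) (hPc.min hQc) (by simp [hP0, hQ0]))
    (hlim (fun s => max (P s) (Q s)) (hPc.max hQc) (by simp [hP0, hQ0])) ?_ ?_
  · filter_upwards [isOpen_Ioo.mem_nhds hs₀] with s hs
    rcases le_total s s₀ with h | h
    · exact (mul_le_mul_of_nonneg_right (min_le_left _ _) (sliceVolume_nonneg A s₀)).trans
        (sliceVolume_left_le hA hconv ha hs.1 h)
    · exact (mul_le_mul_of_nonneg_right (min_le_right _ _) (sliceVolume_nonneg A s₀)).trans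
        (sliceVolume_right_le hA hconv hb h hs.2)
  · filter_upwards [isOpen_Ioo.mem_nhds hs₀] with s hs
    have ha1 : 0 < s - a := sub_pos.2 hs.1
    have hb1 : 0 < b - s := sub_pos.2 hs.2
    rcases le_total s s₀ with h | h
    · refine le_trans ?_ (mul_le_mul_of_nonneg_right (le_max_right _ _) (sliceVolume_nonneg A s₀))
      have h1 := sliceVolume_right_le hA hconv hb h hs₀.2
      rw [← inv_div, inv_pow, inv_mul_le_iff₀ (by positivity)] at h1
      exact h1
    · refine le_trans ?_ (mul_le_mul_of_nonneg_right (le_max_left _ _) (sliceVolume_nonneg A s₀))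
      have h1 := sliceVolume_left_le hA hconv ha hs₀.1 h
      rw [← inv_div, inv_pow, inv_mul_le_iff₀ (by positivity)] at h1
      exact h1

lemma exists_sliceVolume_pos (hA : IsCompact A) (ha : a ∈ lowerBounds (Prod.fst '' A))
    (hb : b ∈ upperBounds (Prod.fst '' A)) (hvol : 0 < volume A) :
    ∃ s ∈ Ioo a b, 0 < sliceVolume A s := by
  by_contra! hcon
  refine hvol.ne' ?_
  rw [← lintegral_sliceVolume hA, lintegral_eq_zero_iff (measurable_sliceVolume hA).ennreal_ofReal]
  have hnull : ({a, b} : Set ℝ)ᶜ ∈ ae (volume : Measure ℝ) :=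
    compl_mem_ae_iff.2 ((toFinite {a, b}).measure_zero _)
  filter_upwards [hnull] with s hs
  rw [Pi.zero_apply, ENNReal.ofReal_eq_zero]
  by_cases hsI : s ∈ Icc a b
  · simp only [mem_compl_iff, mem_insert_iff, mem_singleton_iff, not_or] at hs
    exact hcon s ⟨lt_of_le_of_ne hsI.1 (Ne.symm hs.1), lt_of_le_of_ne hsI.2 hs.2⟩
  · exact (sliceVolume_eq_zero ha hb hsI).le

lemma isPosDensityOn_sliceVolume (hA : IsCompact A) (hconv : Convex ℝ A) (hvol : 0 < volume A)
    (ha : IsLeast (Prod.fst '' A) a) (hb : IsGreatest (Prod.fst '' A) b) :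
    IsPosDensityOn (sliceVolume A) a b := by
  obtain ⟨t, ht, hpos⟩ := exists_sliceVolume_pos hA ha.2 hb.2 hvol
  refine ⟨ht.1.trans ht.2, integrable_sliceVolume hA, fun s hs =>
    (continuousAt_sliceVolume hA hconv ha.1 hb.1 hs).continuousWithinAt, fun s hs => ?_⟩
  have h1 := sub_pos.2 ht.1
  have h2 := sub_pos.2 ht.2
  have h3 := sub_pos.2 hs.1
  have h4 := sub_pos.2 hs.2
  rcases le_total s t with h | h
  · exact lt_of_lt_of_le (by positivity) (sliceVolume_left_le hA hconv ha.1 hs.1 h)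
  · exact lt_of_lt_of_le (by positivity) (sliceVolume_right_le hA hconv hb.1 h hs.2)

lemma intervalIntegral_eq_of_support {f : ℝ → ℝ} (hab : a ≤ b) (hf : ∀ s ∉ Icc a b, f s = 0) :
    ∫ s in a..b, f s = ∫ s, f s := by
  rw [intervalIntegral.integral_of_le hab, ← integral_Icc_eq_integral_Ioc,
    setIntegral_eq_integral_of_forall_compl_eq_zero hf]

lemma intervalIntegral_sliceVolume (hA : IsCompact A) (hab : a ≤ b)
    (ha : a ∈ lowerBounds (Prod.fst '' A)) (hb : b ∈ upperBounds (Prod.fst '' A)) :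
    ∫ s in a..b, sliceVolume A s = volume.real A := by
  rw [intervalIntegral_eq_of_support hab fun s hs => sliceVolume_eq_zero ha hb hs,
    integral_sliceVolume hA]

end

end Slices

section BrunnMinkowski

/-- The multiplicative Brunn–Minkowski inequality at the midpoint, for compact convex sets. -/
def MidpointBrunnMinkowski (E : Type*) [NormedAddCommGroup E] [NormedSpace ℝ E]
    [MeasureSpace E] : Prop :=
  ∀ A B : Set E, IsCompact A → Convex ℝ A → IsCompact B → Convex ℝ B →
    ENNReal.ofReal √(volume.real A * volume.real B) ≤ volume ((2⁻¹ : ℝ) • (A + B))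

variable {E F : Type*} [NormedAddCommGroup E] [NormedSpace ℝ E]
  [NormedAddCommGroup F] [NormedSpace ℝ F]

lemma image_midpoint (L : F ≃L[ℝ] E) (A B : Set F) :
    L '' ((2⁻¹ : ℝ) • (A + B)) = (2⁻¹ : ℝ) • (L '' A + L '' B) := by
  rw [image_smul_set, image_add]

variable [MeasureSpace E] [MeasureSpace F]

lemma MidpointBrunnMinkowski.ofReal_sqrt_sliceVolume_le (hE : MidpointBrunnMinkowski E)
    {A B : Set (ℝ × E)} (hA : IsCompact A) (hAc : Convex ℝ A) (hB : IsCompact B)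
    (hBc : Convex ℝ B) (s t : ℝ) :
    ENNReal.ofReal √(sliceVolume A s * sliceVolume B t) ≤
      volume (Prod.mk ((s + t) / 2) ⁻¹' ((2⁻¹ : ℝ) • (A + B))) := by
  refine (hE _ _ (hA.preimage_prodMk s) (hAc.preimage_prodMk s) (hB.preimage_prodMk t)
    (hBc.preimage_prodMk t)).trans (measure_mono ?_)
  rintro _ ⟨_, ⟨x, hx, y, hy, rfl⟩, rfl⟩
  refine ⟨(s, x) + (t, y), add_mem_add hx hy, ?_⟩
  ext
  · simp
    ring
  · simp

variable [BorelSpace E] [BorelSpace F]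

lemma volume_eq_mul_volume_image {L : F ≃L[ℝ] E} {κ : NNReal}
    (hκ : Measure.map L (volume : Measure F) = κ • (volume : Measure E)) (S : Set F) :
    volume S = κ * volume (L '' S) := by
  have h : Measure.map L (volume : Measure F) (L '' S) = volume S := by
    have := L.toHomeomorph.measurableEmbedding.map_apply volume (L '' S)
    rwa [ContinuousLinearEquiv.coe_toHomeomorph, preimage_image_eq _ L.injective] at this
  rw [← h, hκ]
  simp

variable [(volume : Measure E).IsAddHaarMeasure]
  [(volume : Measure F).IsAddHaarMeasure] [FiniteDimensional ℝ E]

instance : (volume : Measure (ℝ × E)).IsAddHaarMeasure := by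
  rw [Measure.volume_eq_prod]
  infer_instance

lemma MidpointBrunnMinkowski.prod (hE : MidpointBrunnMinkowski E) :
    MidpointBrunnMinkowski (ℝ × E) := by
  intro A B hA hAc hB hBc
  rcases eq_or_ne (volume A) 0 with hA0 | hA0
  · simp [Measure.real, hA0]
  rcases eq_or_ne (volume B) 0 with hB0 | hB0
  · simp [Measure.real, hB0]
  obtain ⟨a, b, ha, hb⟩ := exists_isLeast_isGreatest_fst hA (nonempty_of_measure_ne_zero hA0)
  obtain ⟨c, d, hc, hd⟩ := exists_isLeast_isGreatest_fst hB (nonempty_of_measure_ne_zero hB0)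
  have hf := isPosDensityOn_sliceVolume hA hAc (pos_iff_ne_zero.2 hA0) ha hb
  have hg := isPosDensityOn_sliceVolume hB hBc (pos_iff_ne_zero.2 hB0) hc hd
  rw [← lintegral_volume_preimage_prodMk ((hA.add hB).smul _),
    ← intervalIntegral_sliceVolume hA hf.lt.le ha.2 hb.2,
    ← intervalIntegral_sliceVolume hB hg.lt.le hc.2 hd.2]
  exact hf.ofReal_sqrt_le_lintegral hg _ fun s _ t _ =>
    hE.ofReal_sqrt_sliceVolume_le hA hAc hB hBc s t

lemma ContinuousLinearEquiv.exists_map_volume_eq_smul (L : F ≃L[ℝ] E) :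
    ∃ κ : NNReal, Measure.map L (volume : Measure F) = κ • (volume : Measure E) := by
  have := L.isAddHaarMeasure_map (volume : Measure F)
  exact ⟨_, Measure.isAddLeftInvariant_eq_smul _ _⟩

lemma MidpointBrunnMinkowski.of_equiv (hE : MidpointBrunnMinkowski E) (L : F ≃L[ℝ] E) :
    MidpointBrunnMinkowski F := by
  intro A B hA hAc hB hBc
  obtain ⟨κ, hκ⟩ := L.exists_map_volume_eq_smul
  have h := hE (L '' A) (L '' B) (hA.image L.continuous) (hAc.linear_image L.toLinearMap)
    (hB.image L.continuous) (hBc.linear_image L.toLinearMap)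
  rw [measureReal_def, measureReal_def, volume_eq_mul_volume_image hκ A,
    volume_eq_mul_volume_image hκ B, volume_eq_mul_volume_image hκ ((2⁻¹ : ℝ) • (A + B)),
    image_midpoint, ENNReal.toReal_mul, ENNReal.toReal_mul, mul_mul_mul_comm, ENNReal.coe_toReal,
    Real.sqrt_mul (by positivity), Real.sqrt_mul_self (by positivity),
    ENNReal.ofReal_mul (by positivity), ENNReal.ofReal_coe_nnreal]
  gcongr
  exact h

lemma midpointBrunnMinkowski_pi (n : ℕ) : MidpointBrunnMinkowski (Fin n → ℝ) := by
  induction n with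
  | zero =>
    intro A B _ _ _ _
    rcases A.eq_empty_or_nonempty with rfl | hA
    · simp
    rcases B.eq_empty_or_nonempty with rfl | hB
    · simp
    rw [Subsingleton.eq_univ_of_nonempty hA, Subsingleton.eq_univ_of_nonempty hB,
      Subsingleton.eq_univ_of_nonempty (univ_nonempty.add univ_nonempty).smul_set]
    simp [Measure.real, volume_pi]
  | succ n ih =>
    refine ih.prod.of_equiv (LinearEquiv.ofFinrankEq _ _ ?_).toContinuousLinearEquiv
    simp [add_comm]

lemma sliceVolume_neg (A : Set (ℝ × E)) (s : ℝ) : sliceVolume (-A) s = sliceVolume A (-s) := by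
  have : Prod.mk s ⁻¹' (-A) = -(Prod.mk (-s) ⁻¹' A) := by
    ext
    simp
  rw [sliceVolume, this, measureReal_def, Measure.measure_neg]
  rfl

/-- If `K` is a compact convex set for which `½(K − K)` is no larger than `K`, then the first
coordinate of the centroid of `K` is the midpoint of the range of the first coordinate. -/
lemma MidpointBrunnMinkowski.integral_fst_eq (hE : MidpointBrunnMinkowski E) {K : Set (ℝ × E)}
    (hK : IsCompact K) (hconv : Convex ℝ K) (hvol : 0 < volume K)
    (hle : volume ((2⁻¹ : ℝ) • (K - K)) ≤ volume K) {a b : ℝ}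
    (ha : IsLeast (Prod.fst '' K) a) (hb : IsGreatest (Prod.fst '' K) b) :
    ∫ x in K, x.1 = (a + b) / 2 * volume.real K := by
  have himg : Prod.fst '' (-K) = -(Prod.fst '' K) := image_neg (AddMonoidHom.fst ℝ E) K
  have ha' : IsGreatest (Prod.fst '' (-K)) (-a) :=
    himg ▸ ⟨neg_mem_neg.2 ha.1, fun _ hx => le_neg_of_le_neg (ha.2 hx)⟩
  have hb' : IsLeast (Prod.fst '' (-K)) (-b) :=
    himg ▸ ⟨neg_mem_neg.2 hb.1, fun _ hx => neg_le_of_neg_le (hb.2 hx)⟩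
  have hf := isPosDensityOn_sliceVolume hK hconv hvol ha hb
  have hg := isPosDensityOn_sliceVolume hK.neg hconv.neg (by rwa [Measure.measure_neg]) hb' ha'
  have hV := intervalIntegral_sliceVolume hK hf.lt.le ha.2 hb.2
  have hV' := intervalIntegral_sliceVolume hK.neg hg.lt.le hb'.2 ha'.2
  obtain ⟨e, he, -, hsymm⟩ := hf.exists_translate_of_lintegral_le hg _
    (fun s _ t _ => hE.ofReal_sqrt_sliceVolume_le hK hconv hK.neg hconv.neg s t)
    (by rw [hV, hV', measureReal_def, Measure.measure_neg, measureReal_def])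
    (by
      rw [lintegral_volume_preimage_prodMk ((hK.add hK.neg).smul (2⁻¹ : ℝ)), ← sub_eq_add_neg, hV,
        ofReal_measureReal hK.measure_ne_top]
      exact hle)
  have hsymm' : ∀ s ∈ Ioo a b, sliceVolume K (a + b - s) = sliceVolume K s := fun s hs => by
    rw [← hsymm s hs, sliceVolume_neg]
    congr 1
    linarith
  have hI : ∫ s in a..b, s * sliceVolume K s = ∫ x in K, x.1 := by
    rw [integral_fst_eq_integral_sliceVolume hK]
    refine intervalIntegral_eq_of_support hf.lt.le fun s hs => ?_
    rw [sliceVolume_eq_zero ha.2 hb.2 hs, mul_zero]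
  have hint : IntervalIntegrable (sliceVolume K) volume a b := hf.integrable.intervalIntegrable
  have h1 : ∫ s in a..b, s * sliceVolume K s = ∫ s in a..b, (a + b - s) * sliceVolume K s := by
    have h2 := intervalIntegral.integral_comp_sub_left (a := a) (b := b)
      (fun s => s * sliceVolume K s) (a + b)
    rw [add_sub_cancel_left, add_sub_cancel_right] at h2
    rw [← h2, intervalIntegral.integral_of_le hf.lt.le, intervalIntegral.integral_of_le hf.lt.le,
      integral_Ioc_eq_integral_Ioo, integral_Ioc_eq_integral_Ioo]
    exact setIntegral_congr_fun measurableSet_Ioo fun s hs => by simp only [hsymm' s hs]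
  simp_rw [sub_mul] at h1
  have hint' : IntervalIntegrable (fun s => s * sliceVolume K s) volume a b :=
    hint.continuousOn_mul continuousOn_id
  rw [intervalIntegral.integral_sub (hint.const_mul _) hint',
    intervalIntegral.integral_const_mul, hV, hI] at h1
  linarith

lemma MidpointBrunnMinkowski.integral_fst_equiv_eq (hE : MidpointBrunnMinkowski E)
    (L : F ≃L[ℝ] ℝ × E) {K : Set F}
    (hK : IsCompact K) (hconv : Convex ℝ K) (hvol : 0 < volume K)
    (hle : volume ((2⁻¹ : ℝ) • (K - K)) ≤ volume K) {a b : ℝ}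
    (ha : IsLeast ((fun x => (L x).1) '' K) a) (hb : IsGreatest ((fun x => (L x).1) '' K) b) :
    ∫ x in K, (L x).1 = (a + b) / 2 * volume.real K := by
  obtain ⟨κ, hκ⟩ := L.exists_map_volume_eq_smul
  have himg : (fun x => (L x).1) '' K = Prod.fst '' (L '' K) := by rw [image_image]
  rw [himg] at ha hb
  rw [volume_eq_mul_volume_image hκ] at hvol
  have hκ0 : (κ : ENNReal) ≠ 0 := (CanonicallyOrderedAdd.mul_pos.1 hvol).1.ne'
  rw [volume_eq_mul_volume_image hκ, volume_eq_mul_volume_image hκ K,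
    ENNReal.mul_le_mul_iff_right hκ0 ENNReal.coe_ne_top, sub_eq_add_neg, image_midpoint,
    image_neg L, ← sub_eq_add_neg] at hle
  have h := hE.integral_fst_eq (hK.image L.continuous) (hconv.linear_image L.toLinearMap)
    (CanonicallyOrderedAdd.mul_pos.1 hvol).2 hle ha hb
  have h1 : ∫ x in K, (L x).1 = κ * ∫ y in L '' K, y.1 := by
    have h2 := L.toHomeomorph.measurableEmbedding.setIntegral_map (μ := volume)
      (fun y : ℝ × E => y.1) (L '' K)
    rw [ContinuousLinearEquiv.coe_toHomeomorph, preimage_image_eq _ L.injective, hκ,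
      Measure.restrict_smul, integral_smul_nnreal_measure] at h2
    exact h2.symm
  rw [h1, h, measureReal_def, measureReal_def, volume_eq_mul_volume_image hκ K, ENNReal.toReal_mul,
    ENNReal.coe_toReal]
  ring

end BrunnMinkowski

section EssDiff

lemma mem_essDiff_of_mem_interior {E : Type*} [NormedAddCommGroup E] [MeasureSpace E]
    [(volume : Measure E).IsOpenPosMeasure] {K : Set E} {t x : E} (hx : x ∈ interior K)
    (hxt : x - t ∈ interior K) : t ∈ essDiff K := by
  have hopen : IsOpen (interior K ∩ {x | x - t ∈ interior K}) :=
    isOpen_interior.inter (isOpen_interior.preimage (continuous_id.sub continuous_const))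
  refine (hopen.measure_pos volume ⟨x, hx, hxt⟩).trans_le (measure_mono ?_)
  exact inter_subset_inter interior_subset fun _ hy => interior_subset (s := K) hy

variable {E : Type*} [NormedAddCommGroup E] [NormedSpace ℝ E]

/-- For a convex set `K` with nonempty interior, every `t` such that `(1 + ε) • t ∈ K - K` for some
`ε > 0` is a difference of interior points of `K`. -/
lemma Convex.exists_mem_interior_sub_mem_interior {K : Set E} (hconv : Convex ℝ K)
    (hint : (interior K).Nonempty) {t : E} {ε : ℝ} (hε : 0 < ε) (ht : (1 + ε) • t ∈ K - K) :
    ∃ x ∈ interior K, x - t ∈ interior K := by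
  obtain ⟨p, hp, q, hq, hpq⟩ := ht
  obtain ⟨k, hk⟩ := hint
  have h1 : 0 < 1 + ε := by linarith
  have hmem : ∀ y ∈ K, (ε / (1 + ε)) • k + (1 / (1 + ε)) • y ∈ interior K := fun y hy =>
    hconv.combo_interior_self_mem_interior hk hy (by positivity) (by positivity)
      (by field_simp; ring)
  refine ⟨_, hmem p hp, ?_⟩
  convert hmem q hq using 1
  have h2 : t = (1 / (1 + ε)) • (p - q) := by
    rw [show p - q = (1 + ε) • t from hpq, smul_smul, one_div_mul_cancel h1.ne', one_smul]
  rw [h2, smul_sub]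
  abel

lemma Convex.half_sub_sub_half_sub_subset {K : Set E} (hconv : Convex ℝ K) :
    (2⁻¹ : ℝ) • (K - K) - (2⁻¹ : ℝ) • (K - K) ⊆ K - K := by
  rintro _ ⟨_, ⟨_, ⟨a, ha, b, hb, rfl⟩, rfl⟩, _, ⟨_, ⟨c, hc, d, hd, rfl⟩, rfl⟩, rfl⟩
  have h2 : (0 : ℝ) ≤ 2⁻¹ := by norm_num
  refine ⟨_, hconv ha hd h2 h2 (by norm_num), _, hconv hb hc h2 h2 (by norm_num), ?_⟩
  simp only [smul_sub]
  abel

lemma eventually_one_add_smul_mem {D : Set E} {x : E} (hx : x ∈ interior D) :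
    ∀ᶠ ε : ℝ in nhds 0, (1 + ε) • x ∈ D := by
  have hc : Filter.Tendsto (fun ε : ℝ => (1 + ε) • x) (nhds 0) (nhds x) :=
    (by fun_prop : Continuous fun ε : ℝ => (1 + ε) • x).tendsto' _ _ (by simp)
  exact hc.eventually (mem_interior_iff_mem_nhds.1 hx)

variable [MeasureSpace E] [BorelSpace E] [FiniteDimensional ℝ E]
  [(volume : Measure E).IsAddHaarMeasure]

lemma Convex.nonempty_interior_of_volume_pos {A : Set E} (hA : Convex ℝ A) (h : 0 < volume A) :
    (interior A).Nonempty := by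
  by_contra hcon
  rw [not_nonempty_iff_eq_empty] at hcon
  refine h.ne' (measure_mono_null ?_ (hA.addHaar_frontier volume))
  rw [frontier, hcon, sdiff_empty]
  exact subset_closure

lemma Convex.exists_mem_interior_of_mem_essDiff {D : Set E} (hD : Convex ℝ D) {t : E}
    (ht : t ∈ essDiff D) : ∃ x ∈ interior D, x - t ∈ interior D := by
  have hconv : Convex ℝ (D ∩ {x | x - t ∈ D}) := by
    refine hD.inter ?_
    have := hD.translate_preimage_left (-t)
    simpa [preimage, sub_eq_add_neg] using this
  obtain ⟨x, hx⟩ := hconv.nonempty_interior_of_volume_pos ht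
  rw [interior_inter] at hx
  refine ⟨x, hx.1, ?_⟩
  have : {x | x - t ∈ D} = (Homeomorph.subRight t) ⁻¹' D := rfl
  rw [this, ← Homeomorph.preimage_interior] at hx
  exact hx.2

/-- The difference body of a convex body, scaled by one half, is a packing region for it. -/
lemma Convex.essDiff_half_sub_subset {K : Set E} (hconv : Convex ℝ K)
    (hint : (interior K).Nonempty) : essDiff ((2⁻¹ : ℝ) • (K - K)) ⊆ essDiff K := by
  intro t ht
  obtain ⟨x, hx, hxt⟩ := ((hconv.sub hconv).smul (2⁻¹ : ℝ)).exists_mem_interior_of_mem_essDiff ht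
  obtain ⟨ε, ⟨h1, h2⟩, hε⟩ := (((eventually_one_add_smul_mem hx).and
    (eventually_one_add_smul_mem hxt)).filter_mono nhdsWithin_le_nhds |>.and
      (self_mem_nhdsWithin : Ioi (0 : ℝ) ∈ nhdsWithin 0 (Ioi 0))).exists
  have h3 := hconv.half_sub_sub_half_sub_subset (sub_mem_sub h1 h2)
  rw [← smul_sub, sub_sub_cancel] at h3
  obtain ⟨y, hy, hyt⟩ := hconv.exists_mem_interior_sub_mem_interior hint hε h3
  exact mem_essDiff_of_mem_interior hy hyt

end EssDiff

lemma exists_equiv_prod_fst_eq {n : ℕ} {u : (Fin (n + 1) → ℝ) →L[ℝ] ℝ} (hu : u ≠ 0) :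
    ∃ L : (Fin (n + 1) → ℝ) ≃L[ℝ] ℝ × (Fin n → ℝ), ∀ x, (L x).1 = u x := by
  obtain ⟨v, hv⟩ := DFunLike.ne_iff.1 hu
  rw [zero_apply] at hv
  let L₁ := ContinuousLinearEquiv.equivOfRightInverse u
    (ContinuousLinearMap.toSpanSingleton ℝ ((u v)⁻¹ • v)) fun c => by simp [hv]
  have hrank : Module.finrank ℝ u.ker = Module.finrank ℝ (Fin n → ℝ) := by
    have := L₁.toLinearEquiv.finrank_eq
    simp only [Module.finrank_fin_fun, Module.finrank_prod, Module.finrank_self] at this ⊢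
    omega
  exact ⟨L₁.trans ((ContinuousLinearEquiv.refl ℝ ℝ).prodCongr
    (LinearEquiv.ofFinrankEq _ _ hrank).toContinuousLinearEquiv), fun _ => rfl⟩

/-- If `½(K − K)` is no larger than the convex body `K`, then `K` is symmetric about its
centroid. -/
lemma Convex.centroid_reflection_mem {n : ℕ} {K : Set (Fin (n + 1) → ℝ)} (hconv : Convex ℝ K)
    (hcomp : IsCompact K) (hint : (interior K).Nonempty)
    (hle : volume ((2⁻¹ : ℝ) • (K - K)) ≤ volume K) {x : Fin (n + 1) → ℝ} (hx : x ∈ K) :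
    (volume.real K)⁻¹ • (∫ y in K, y) + (volume.real K)⁻¹ • (∫ y in K, y) - x ∈ K := by
  by_contra hnot
  obtain ⟨u, r, hur, hr⟩ := geometric_hahn_banach_closed_point hconv hcomp.isClosed hnot
  have hu : u ≠ 0 := by
    rintro rfl
    exact lt_asymm (hur x hx) hr
  obtain ⟨L, hL⟩ := exists_equiv_prod_fst_eq hu
  obtain ⟨a, ha⟩ := (hcomp.image u.continuous).exists_isLeast ⟨u x, mem_image_of_mem u hx⟩
  obtain ⟨b, hb⟩ := (hcomp.image u.continuous).exists_isGreatest ⟨u x, mem_image_of_mem u hx⟩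
  have hvol : 0 < volume K := Measure.measure_pos_of_nonempty_interior volume hint
  have hreal : 0 < volume.real K := ENNReal.toReal_pos hvol.ne' hcomp.measure_ne_top
  have h := (midpointBrunnMinkowski_pi n).integral_fst_equiv_eq L hcomp hconv hvol hle (a := a)
    (b := b) (by simpa only [hL] using ha) (by simpa only [hL] using hb)
  simp only [hL] at h
  rw [u.integral_comp_comm (continuous_id'.continuousOn.integrableOn_compact hcomp)] at h
  obtain ⟨y, hy, hyb⟩ := hb.1
  have hyr := hur y hy
  have hax := ha.2 (mem_image_of_mem u hx)
  have hc : (volume.real K)⁻¹ * u (∫ y in K, y) = (a + b) / 2 := by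
    rw [h]
    field_simp
  rw [map_sub, map_add, map_smul, smul_eq_mul, hc] at hr
  linarith

/-- For a convex body `K` which is not centrally symmetric, `D = ½(K − K)` is a packing
region for `K` with `m(D) > m(K)`. -/
theorem half_difference_body_packing_region (d : ℕ) (K : Set (Fin d → ℝ))
    (hconv : Convex ℝ K) (hcomp : IsCompact K) (hint : (interior K).Nonempty)
    (hnotsym : ¬ ∃ c : Fin d → ℝ, ∀ x, x ∈ K ↔ c + c - x ∈ K) :
    essDiff ((2⁻¹ : ℝ) • (K - K)) ⊆ essDiff K ∧
      volume K < volume ((2⁻¹ : ℝ) • (K - K)) := by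
  refine ⟨hconv.essDiff_half_sub_subset hint, ?_⟩
  by_contra! hle
  obtain ⟨x₀, hx₀⟩ := hint.mono interior_subset
  cases d with
  | zero =>
    exact hnotsym ⟨x₀, fun x => by rw [Subsingleton.elim (x₀ + x₀ - x) x]⟩
  | succ n =>
    refine hnotsym ⟨_, fun x => ⟨hconv.centroid_reflection_mem hcomp hint hle, fun hx => ?_⟩⟩
    simpa using hconv.centroid_reflection_mem hcomp hint hle hx
end
end

section
/- Let A ⊂ ℝᵈ be a centrally symmetric convex body with −A = A. Then Δ(A) = 2·int(A), and consequently every packing region D for A satisfies m(D) ≤ m(A). -/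
open MeasureTheory Set Pointwise

noncomputable section

theorem Real.volume_add_le_of_add_subset_of_isCompact {K L S : Set ℝ} (hK : IsCompact K)
    (hL : IsCompact L) (hK₀ : K.Nonempty) (hL₀ : L.Nonempty) (h : K + L ⊆ S) :
    volume K + volume L ≤ volume S := by
  obtain ⟨a, ha, ha_max⟩ := hK.exists_isGreatest hK₀
  obtain ⟨b, hb, hb_min⟩ := hL.exists_isLeast hL₀
  have h_inter : volume ((b +ᵥ K) ∩ (a +ᵥ L)) = 0 := by
    refine measure_mono_null (t := {a + b}) ?_ (measure_singleton _)
    rintro _ ⟨⟨x, hx, rfl⟩, ⟨y, hy, hxy⟩⟩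
    have h₁ := ha_max hx
    have h₂ := hb_min hy
    simp only [vadd_eq_add, mem_singleton_iff] at *
    linarith
  have h_sub : (b +ᵥ K) ∪ (a +ᵥ L) ⊆ S := by
    rintro _ (⟨x, hx, rfl⟩ | ⟨y, hy, rfl⟩)
    · exact h ⟨x, hx, b, hb, add_comm _ _⟩
    · exact h ⟨a, ha, y, hy, rfl⟩
  calc volume K + volume L = volume (b +ᵥ K) + volume (a +ᵥ L) := by
        rw [measure_vadd, measure_vadd]
    _ = volume ((b +ᵥ K) ∪ (a +ᵥ L)) := by
        rw [← measure_union_add_inter _ (hL.measurableSet.const_vadd a), h_inter, add_zero]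
    _ ≤ volume S := measure_mono h_sub

/-- The one-dimensional Brunn–Minkowski inequality. -/
theorem Real.volume_add_le_of_add_subset {A B S : Set ℝ} (hA : MeasurableSet A)
    (hB : MeasurableSet B) (hA₀ : A.Nonempty) (hB₀ : B.Nonempty) (h : A + B ⊆ S) :
    volume A + volume B ≤ volume S := by
  obtain ⟨a, ha⟩ := hA₀
  obtain ⟨b, hb⟩ := hB₀
  rw [hA.measure_eq_iSup_isCompact, hB.measure_eq_iSup_isCompact]
  simp only [iSup_and']
  refine ENNReal.biSup_add_biSup_le' (p := fun K => K ⊆ A ∧ IsCompact K)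
    (q := fun K => K ⊆ B ∧ IsCompact K) ⟨∅, empty_subset _, isCompact_empty⟩
    ⟨∅, empty_subset _, isCompact_empty⟩ fun K hK L hL => ?_
  calc volume K + volume L ≤ volume (insert a K) + volume (insert b L) := by
        gcongr <;> exact subset_insert _ _
    _ ≤ volume S := Real.volume_add_le_of_add_subset_of_isCompact (hK.2.insert a) (hL.2.insert b)
        (insert_nonempty _ _) (insert_nonempty _ _)
        ((add_subset_add (insert_subset ha hK.1) (insert_subset hb hL.1)).trans h)

theorem ENNReal.volume_ofReal_lt (c : ENNReal) :
    volume {t : ℝ | 0 < t ∧ ENNReal.ofReal t < c} = c := by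
  induction c with
  | top => simpa [Ioi] using Real.volume_Ioi (a := 0)
  | coe c =>
    have : {t : ℝ | 0 < t ∧ ENNReal.ofReal t < c} = Ioo 0 (c : ℝ) := by
      ext t
      simp only [mem_ofPred_eq, mem_Ioo, and_congr_right_iff]
      intro ht
      rw [ENNReal.ofReal_lt_coe_iff ht.le]
    rw [this, Real.volume_Ioo, sub_zero, ENNReal.ofReal_coe_nnreal]

theorem lintegral_eq_lintegral_meas_ofReal_lt {α : Type*} [MeasurableSpace α] (μ : Measure α)
    [SFinite μ] {f : α → ENNReal} (hf : Measurable f) :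
    ∫⁻ x, f x ∂μ = ∫⁻ t in Ioi (0 : ℝ), μ {x | ENNReal.ofReal t < f x} := by
  have hS : MeasurableSet {p : α × ℝ | 0 < p.2 ∧ ENNReal.ofReal p.2 < f p.1} :=
    (measurableSet_lt measurable_const measurable_snd).inter
      (measurableSet_lt (ENNReal.measurable_ofReal.comp measurable_snd) (hf.comp measurable_fst))
  have h₁ := Measure.prod_apply (μ := μ) (ν := volume) hS
  have h₂ := Measure.prod_apply_symm (μ := μ) (ν := volume) hS
  rw [h₂] at h₁
  have h₃ : ∀ x, volume (Prod.mk x ⁻¹' {p : α × ℝ | 0 < p.2 ∧ ENNReal.ofReal p.2 < f p.1}) = f x :=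
    fun x => ENNReal.volume_ofReal_lt (f x)
  simp only [h₃] at h₁
  rw [← h₁, ← lintegral_indicator measurableSet_Ioi]
  congr 1 with t
  by_cases ht : 0 < t <;> simp [indicator, ht]

theorem lintegral_add_lintegral_le_of_iSup_eq {f g h : ℝ → ENNReal} (hf : Measurable f)
    (hg : Measurable g) (hh : Measurable h) (hfg : ⨆ x, f x = ⨆ x, g x)
    (H : ∀ x y, f x * g y ≤ h (x + y) ^ 2) :
    (∫⁻ x, f x) + ∫⁻ x, g x ≤ ∫⁻ x, h x := by
  rw [lintegral_eq_lintegral_meas_ofReal_lt _ hf, lintegral_eq_lintegral_meas_ofReal_lt _ hg,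
    lintegral_eq_lintegral_meas_ofReal_lt _ hh, ← lintegral_add_left]
  · refine lintegral_mono fun t => ?_
    by_cases ht : ENNReal.ofReal t < ⨆ x, f x
    · refine Real.volume_add_le_of_add_subset (measurableSet_lt measurable_const hf)
        (measurableSet_lt measurable_const hg) (lt_iSup_iff.1 ht)
        (lt_iSup_iff.1 (hfg ▸ ht : _ < ⨆ x, g x)) ?_
      rintro _ ⟨x, hx, y, hy, rfl⟩
      simp only [mem_ofPred_eq] at *
      rw [← ENNReal.pow_lt_pow_left_iff two_ne_zero]
      refine lt_of_lt_of_le ?_ (H x y)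
      rw [sq]
      exact ENNReal.mul_lt_mul hx hy
    · have h₁ : {x | ENNReal.ofReal t < f x} = ∅ :=
        eq_empty_of_forall_notMem fun x hx => ht (lt_of_lt_of_le hx (le_iSup f x))
      have h₂ : {x | ENNReal.ofReal t < g x} = ∅ :=
        eq_empty_of_forall_notMem fun x hx => ht (hfg ▸ lt_of_lt_of_le hx (le_iSup g x))
      simp [h₁, h₂]
  · refine Antitone.measurable fun s t hst => measure_mono fun x hx => ?_
    exact lt_of_le_of_lt (ENNReal.ofReal_le_ofReal hst) hx

theorem ENNReal.four_mul_le_sq_add (a b : ENNReal) : 4 * a * b ≤ (a + b) ^ 2 := by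
  induction a with
  | top => simp
  | coe a =>
    induction b with
    | top => simp
    | coe b => exact_mod_cast _root_.four_mul_le_sq_add a b

theorem four_mul_lintegral_mul_lintegral_le_of_iSup_ne_top {f g h : ℝ → ENNReal} (hf : Measurable f)
    (hg : Measurable g) (hh : Measurable h) (hf_top : ⨆ x, f x ≠ ⊤) (hg_top : ⨆ x, g x ≠ ⊤)
    (H : ∀ x y, f x * g y ≤ h (x + y) ^ 2) :
    4 * (∫⁻ x, f x) * (∫⁻ x, g x) ≤ (∫⁻ x, h x) ^ 2 := by
  by_cases hf₀ : ⨆ x, f x = 0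
  · simp [ENNReal.iSup_eq_zero.1 hf₀]
  by_cases hg₀ : ⨆ x, g x = 0
  · simp [ENNReal.iSup_eq_zero.1 hg₀]
  obtain ⟨c, hc₀, hc_top, hc⟩ : ∃ c : ENNReal, c ≠ 0 ∧ c ≠ ⊤ ∧
      c * ⨆ x, f x = c⁻¹ * ⨆ x, g x := by
    generalize ⨆ x, f x = a at *
    generalize ⨆ x, g x = b at *
    obtain ⟨u, rfl⟩ : ∃ u : ENNReal, u ^ 2 = a :=
      ⟨a ^ (2⁻¹ : ℝ), by rw [← ENNReal.rpow_natCast, ← ENNReal.rpow_mul]; simp⟩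
    obtain ⟨v, rfl⟩ : ∃ v : ENNReal, v ^ 2 = b :=
      ⟨b ^ (2⁻¹ : ℝ), by rw [← ENNReal.rpow_natCast, ← ENNReal.rpow_mul]; simp⟩
    have hu₀ : u ≠ 0 := by simpa using hf₀
    have hv₀ : v ≠ 0 := by simpa using hg₀
    have hu : u ≠ ⊤ := by simpa using hf_top
    have hv : v ≠ ⊤ := by simpa using hg_top
    refine ⟨v / u, by simp [hv₀, hu], ENNReal.div_ne_top hv hu₀, ?_⟩
    rw [ENNReal.inv_div (Or.inl hu) (Or.inl hu₀), sq, sq, ← mul_assoc, ← mul_assoc,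
      ENNReal.div_mul_cancel hu₀ hu, ENNReal.div_mul_cancel hv₀ hv, mul_comm]
  have hcc : c * c⁻¹ = 1 := ENNReal.mul_inv_cancel hc₀ hc_top
  have key := lintegral_add_lintegral_le_of_iSup_eq (hf.const_mul c) (hg.const_mul c⁻¹) hh
    (by rw [← ENNReal.mul_iSup, ← ENNReal.mul_iSup, hc]) fun x y => by
      calc c * f x * (c⁻¹ * g y) = c * c⁻¹ * (f x * g y) := by ring
        _ ≤ h (x + y) ^ 2 := by rw [hcc, one_mul]; exact H x y
  rw [lintegral_const_mul _ hf, lintegral_const_mul _ hg] at key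
  calc 4 * (∫⁻ x, f x) * (∫⁻ x, g x)
      = c * c⁻¹ * (4 * (∫⁻ x, f x) * (∫⁻ x, g x)) := by rw [hcc, one_mul]
    _ = 4 * (c * ∫⁻ x, f x) * (c⁻¹ * ∫⁻ x, g x) := by ring
    _ ≤ (c * (∫⁻ x, f x) + c⁻¹ * ∫⁻ x, g x) ^ 2 := ENNReal.four_mul_le_sq_add _ _
    _ ≤ (∫⁻ x, h x) ^ 2 := by gcongr

theorem tendsto_lintegral_min_natCast {α : Type*} [MeasurableSpace α] (μ : Measure α)
    {f : α → ENNReal} (hf : Measurable f) :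
    Filter.Tendsto (fun n : ℕ => ∫⁻ x, min (f x) n ∂μ) Filter.atTop (nhds (∫⁻ x, f x ∂μ)) := by
  refine lintegral_tendsto_of_tendsto_of_monotone (fun n => (hf.min measurable_const).aemeasurable)
    (.of_forall fun x m n hmn => by dsimp only; gcongr) (.of_forall fun x => ?_)
  simpa using (tendsto_const_nhds (x := f x)).min ENNReal.tendsto_nat_nhds_top

/-- The one-dimensional Prékopa–Leindler inequality, for the exponent `1 / 2`. -/
theorem four_mul_lintegral_mul_lintegral_le {f g h : ℝ → ENNReal} (hf : Measurable f)
    (hg : Measurable g) (hh : Measurable h) (H : ∀ x y, f x * g y ≤ h (x + y) ^ 2) :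
    4 * (∫⁻ x, f x) * (∫⁻ x, g x) ≤ (∫⁻ x, h x) ^ 2 := by
  by_cases hf₀ : ∫⁻ x, f x = 0
  · simp [hf₀]
  by_cases hg₀ : ∫⁻ x, g x = 0
  · simp [hg₀]
  rw [mul_assoc]
  refine le_of_tendsto (ENNReal.Tendsto.const_mul (a := 4) (ENNReal.Tendsto.mul
    (tendsto_lintegral_min_natCast volume hf) (Or.inl hf₀)
    (tendsto_lintegral_min_natCast volume hg) (Or.inl hg₀)) (Or.inr (by simp)))
    (.of_forall fun n => ?_)
  rw [← mul_assoc]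
  refine four_mul_lintegral_mul_lintegral_le_of_iSup_ne_top (hf.min measurable_const)
    (hg.min measurable_const) hh ?_ ?_ fun x y =>
      le_trans (by gcongr <;> exact min_le_left _ _) (H x y)
  all_goals exact ne_top_of_le_ne_top (ENNReal.natCast_ne_top n) (iSup_le fun x => min_le_right _ _)

theorem lintegral_fin_succ {n : ℕ} (f : (Fin (n + 1) → ℝ) → ENNReal) (hf : Measurable f) :
    ∫⁻ x, f x = ∫⁻ s : ℝ, ∫⁻ y : Fin n → ℝ, f (Fin.cons s y) := by
  have e := (volume_preserving_piFinSuccAbove (fun _ : Fin (n + 1) => ℝ) 0).symm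
  rw [← e.lintegral_comp hf, Measure.volume_eq_prod, lintegral_prod]
  · simp [Fin.consEquiv]
  · exact (hf.comp e.measurable).aemeasurable

/-- The Prékopa–Leindler inequality, for the exponent `1 / 2`. -/
theorem four_pow_mul_lintegral_mul_lintegral_le {n : ℕ} {f g h : (Fin n → ℝ) → ENNReal}
    (hf : Measurable f) (hg : Measurable g) (hh : Measurable h)
    (H : ∀ x y, f x * g y ≤ h (x + y) ^ 2) :
    4 ^ n * (∫⁻ x, f x) * ∫⁻ x, g x ≤ (∫⁻ x, h x) ^ 2 := by
  induction n with
  | zero =>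
    have h₀ := H default default
    rw [Subsingleton.elim (default + default : Fin 0 → ℝ) default] at h₀
    rw [lintegral_unique, lintegral_unique, lintegral_unique]
    simp only [volume_pi, Measure.pi_empty_univ, mul_one, pow_zero, one_mul]
    convert h₀
  | succ n ih =>
    have h_cons : Measurable fun p : ℝ × (Fin n → ℝ) => (Fin.cons p.1 p.2 : Fin (n + 1) → ℝ) := by
      refine measurable_pi_lambda _ fun i => ?_
      refine Fin.cases ?_ (fun j => ?_) i
      · simpa using measurable_fst
      · simpa using measurable_snd.eval
    have h_slice : ∀ s : ℝ, Measurable fun y : Fin n → ℝ => (Fin.cons s y : Fin (n + 1) → ℝ) :=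
      fun s => h_cons.comp measurable_prodMk_left
    have hF := (hf.comp h_cons).lintegral_prod_right' (ν := volume)
    have hG := (hg.comp h_cons).lintegral_prod_right' (ν := volume)
    have hH := (hh.comp h_cons).lintegral_prod_right' (ν := volume)
    rw [lintegral_fin_succ f hf, lintegral_fin_succ g hg, lintegral_fin_succ h hh]
    have key := four_mul_lintegral_mul_lintegral_le (hF.const_mul (4 ^ n)) hG hH fun s t =>
      ih (hf.comp (h_slice s)) (hg.comp (h_slice t)) (hh.comp (h_slice (s + t))) fun x y => by
        have h_add : (Fin.cons s x + Fin.cons t y : Fin (n + 1) → ℝ) = Fin.cons (s + t) (x + y) := by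
          ext i
          cases i using Fin.cases <;> simp
        simpa [h_add] using H (Fin.cons s x) (Fin.cons t y)
    rw [lintegral_const_mul _ hF] at key
    refine le_trans (le_of_eq ?_) key
    simp only [Function.comp_apply]
    ring

theorem two_pow_mul_volume_le_of_sub_subset {n : ℕ} {A S : Set (Fin n → ℝ)}
    (hA : MeasurableSet A) (hS : MeasurableSet S) (h : A - A ⊆ S) :
    2 ^ n * volume A ≤ volume S := by
  have key := four_pow_mul_lintegral_mul_lintegral_le (f := A.indicator 1) (g := (-A).indicator 1)
    (h := S.indicator 1) (measurable_one.indicator hA) (measurable_one.indicator hA.neg)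
    (measurable_one.indicator hS) fun x y => by
      by_cases hx : x ∈ A
      · by_cases hy : y ∈ -A
        · have : x + y ∈ S := h ⟨x, hx, -y, hy, by simp⟩
          simp [hx, this, indicator_of_mem hy]
        · simp [indicator_of_notMem hy]
      · simp [hx]
  rw [lintegral_indicator_one hA, lintegral_indicator_one hA.neg, lintegral_indicator_one hS,
    Measure.measure_neg] at key
  rw [← ENNReal.pow_le_pow_left_iff two_ne_zero]
  refine le_trans (le_of_eq ?_) key
  rw [mul_pow, ← pow_mul, mul_comm n, pow_mul]
  norm_num
  ring

open Filter Metric in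
/-- Almost all of a measurable set, namely its points of density one, has all its differences in
the essential difference set. -/
theorem exists_measurableSet_sub_subset_essDiff {n : ℕ} {D : Set (Fin n → ℝ)}
    (hD : MeasurableSet D) :
    ∃ T, MeasurableSet T ∧ volume T = volume D ∧ T - T ⊆ essDiff D := by
  set P : (Fin n → ℝ) → Prop := fun x => Tendsto
    (fun r => volume (D ∩ closedBall x r) / volume (closedBall x r)) (nhdsWithin 0 (Ioi 0))
    (nhds (D.indicator 1 x)) with hP
  have h_ae : ∀ᵐ x, P x := Besicovitch.ae_tendsto_measure_inter_div_of_measurableSet volume hD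
  obtain ⟨G, hG_ae, hG, hGP⟩ := h_ae.exists_measurable_mem
  refine ⟨D ∩ G, hD.inter hG, by rw [inter_comm]; exact Measure.measure_inter_eq_of_ae hG_ae, ?_⟩
  have h_half : ∀ x ∈ D ∩ G, ∀ᶠ r in nhdsWithin (0 : ℝ) (Ioi 0),
      volume (closedBall x r) / 2 < volume (D ∩ closedBall x r) := by
    rintro x ⟨hx, hxG⟩
    have h₁ : P x := hGP x hxG
    rw [hP, indicator_of_mem hx, Pi.one_apply] at h₁
    filter_upwards [h₁.eventually (lt_mem_nhds (ENNReal.inv_lt_one.2 ENNReal.one_lt_two)),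
      self_mem_nhdsWithin] with r hr hr₀
    rw [ENNReal.lt_div_iff_mul_lt
      (Or.inl (measure_closedBall_pos volume x hr₀).ne')
      (Or.inl measure_closedBall_lt_top.ne)] at hr
    rwa [div_eq_mul_inv, mul_comm]
  rintro _ ⟨x, hx, y, hy, rfl⟩
  obtain ⟨r, hrx, hry⟩ := ((h_half x hx).and (h_half y hy)).exists
  rw [essDiff, mem_ofPred_eq, pos_iff_ne_zero]
  intro h₀
  set D' := {z | z - (x - y) ∈ D} with hD'
  have hmD' : MeasurableSet D' := (measurable_id.sub_const (x - y)) hD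
  have h_trans : volume (D' ∩ closedBall x r) = volume (D ∩ closedBall y r) := by
    rw [← (measurePreserving_sub_right volume (x - y)).measure_preimage
      (hD.inter measurableSet_closedBall).nullMeasurableSet]
    congr 1
    ext z
    simp only [hD', mem_inter_iff, mem_ofPred_eq, mem_preimage, mem_closedBall, dist_eq_norm]
    rw [show z - (x - y) - y = z - x by abel]
  have h_ball : volume (closedBall y r) = volume (closedBall x r) := by
    rw [Measure.addHaar_closedBall_center, Measure.addHaar_closedBall_center volume x]
  have h_inter : volume ((D ∩ closedBall x r) ∩ (D' ∩ closedBall x r)) = 0 :=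
    measure_mono_null (inter_subset_inter inter_subset_left inter_subset_left) h₀
  have h_sum := measure_union_add_inter (μ := volume) (D ∩ closedBall x r)
    (hmD'.inter measurableSet_closedBall : MeasurableSet (D' ∩ closedBall x r))
  rw [h_inter, add_zero, h_trans] at h_sum
  rw [h_ball] at hry
  refine absurd (ENNReal.add_lt_add hrx hry) (not_lt.2 ?_)
  rw [ENNReal.add_halves, ← h_sum]
  exact measure_mono (union_subset inter_subset_right inter_subset_right)

theorem Convex.essDiff_eq {n : ℕ} {A : Set (Fin n → ℝ)} (hA : Convex ℝ A) (hA_symm : -A = A) :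
    essDiff A = (2 : ℝ) • interior A := by
  have h_neg : ∀ x ∈ interior A, -x ∈ interior A := fun x hx => by
    have h : -interior A = interior (-A) := (Homeomorph.neg _).preimage_interior A
    rwa [← Set.mem_neg, h, hA_symm]
  apply Subset.antisymm
  · intro t ht
    have h_null : volume (frontier A ∪ (fun x => x - t) ⁻¹' frontier A) = 0 := by
      rw [measure_union_null_iff, (measurePreserving_sub_right volume t).measure_preimage
        isClosed_frontier.measurableSet.nullMeasurableSet]
      exact ⟨hA.addHaar_frontier volume, hA.addHaar_frontier volume⟩
    obtain ⟨x, ⟨hx, hxt⟩, hx'⟩ : ((A ∩ {x | x - t ∈ A}) \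
        (frontier A ∪ (fun x => x - t) ⁻¹' frontier A)).Nonempty := by
      refine nonempty_of_measure_ne_zero (μ := volume) ?_
      rw [measure_sdiff_null h_null]
      exact ht.ne'
    simp only [mem_union, mem_preimage, not_or] at hx'
    have h_int : ∀ z ∈ A, z ∉ frontier A → z ∈ interior A := fun z hz hz' => by
      by_contra h
      exact hz' ⟨subset_closure hz, h⟩
    refine ⟨(2⁻¹ : ℝ) • x + (2⁻¹ : ℝ) • -(x - t), hA.interior (h_int x hx hx'.1)
      (h_neg _ (h_int _ hxt hx'.2)) (by norm_num) (by norm_num) (by norm_num), ?_⟩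
    ext i
    simp
    ring
  · rintro _ ⟨a, ha, rfl⟩
    have h_open : IsOpen (interior A ∩ {x | x - (2 : ℝ) • a ∈ interior A}) :=
      isOpen_interior.inter (isOpen_interior.preimage (continuous_id.sub continuous_const))
    refine lt_of_lt_of_le (h_open.measure_pos volume ⟨a, ha, ?_⟩) (measure_mono
      (inter_subset_inter interior_subset
        (ofPred_subset_ofPred.2 fun x hx => interior_subset hx)))
    have : a - (2 : ℝ) • a = -a := by rw [two_smul]; abel
    simpa [this] using h_neg a ha

/-- For a centrally symmetric convex body `A = -A`, the essential difference set is
`2 · int(A)`, and consequently every packing region `D` for `A` has `m(D) ≤ m(A)`. -/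
theorem essDiff_of_symmetric_convex_body (d : ℕ) (A : Set (Fin d → ℝ))
    (hconv : Convex ℝ A) (hcomp : IsCompact A) (hint : (interior A).Nonempty)
    (hsym : -A = A) :
    essDiff A = (2 : ℝ) • interior A ∧
      ∀ D : Set (Fin d → ℝ), Bornology.IsBounded D → MeasurableSet D →
        essDiff D ⊆ essDiff A → volume D ≤ volume A := by
  refine ⟨hconv.essDiff_eq hsym, fun D _ hD hDA => ?_⟩
  obtain ⟨T, hT, hT_vol, hT_sub⟩ := exists_measurableSet_sub_subset_essDiff hD
  rw [hconv.essDiff_eq hsym] at hDA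
  have key := two_pow_mul_volume_le_of_sub_subset hT
    (isOpen_interior.smul₀ (two_ne_zero (α := ℝ))).measurableSet (hT_sub.trans hDA)
  rw [Measure.addHaar_smul, hT_vol, Module.finrank_fin_fun, abs_of_nonneg (by positivity),
    ENNReal.ofReal_pow zero_le_two, ENNReal.ofReal_ofNat,
    ENNReal.mul_le_mul_iff_right (by simp) (by simp)] at key
  exact key.trans (measure_mono interior_subset)
end
end
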